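/- arXiv:1907.08933 — 3 statements merged into one kernel-verified Lean document; each statement's English description precedes it below -/
import Mathlib

section
/- Let V be a finite-dimensional real vector space, u : V → ℝ linear, K ⊆ {v : u(v) = 1} compact convex, φ ∈ K ⊗̂ K, and let f_A, f_{A'}, f_B, f_{B'} be linear effects on K. If the CHSH quantity X = E(A,B) + E(A,B') + E(A',B) − E(A',B') computed from φ equals 4, then both pairs (f_A, f_{A'}) and (f_B, f_{B'}) admit witness squares; in particular both corresponding pairs of two-outcome measurements are maximally incompatible. -/
open TensorProduct

/-- Evaluation of the functional `h ⊗ h'` on an element of `V ⊗ V`. -/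
noncomputable def tpair {V : Type*} [AddCommGroup V] [Module ℝ V]
    (h h' : V →ₗ[ℝ] ℝ) : TensorProduct ℝ V V →ₗ[ℝ] ℝ :=
  TensorProduct.lift ((LinearMap.mul ℝ ℝ).compl₁₂ h h')

/-- A linear effect on `K`: a linear functional with values in `[0,1]` on `K`. -/
def IsLinEffect {V : Type*} [AddCommGroup V] [Module ℝ V]
    (K : Set V) (f : V →ₗ[ℝ] ℝ) : Prop :=
  ∀ x ∈ K, 0 ≤ f x ∧ f x ≤ 1

/-- A witness square for the pair of linear effects `(f, g)` on `K`. -/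
def IsWitnessSquare {V : Type*} [AddCommGroup V] [Module ℝ V]
    (K : Set V) (f g : V →ₗ[ℝ] ℝ) (x : Fin 2 → Fin 2 → V) : Prop :=
  (∀ i j, x i j ∈ K) ∧ x 0 0 + x 1 1 = x 1 0 + x 0 1 ∧
    (∀ i j, f (x i j) = ((i : ℕ) : ℝ)) ∧ (∀ i j, g (x i j) = ((j : ℕ) : ℝ))

/-- The contraction of the second tensor factor of `φ` against a linear functional. -/
noncomputable def steeringMap {V : Type*} [AddCommGroup V] [Module ℝ V]
    (φ : TensorProduct ℝ V V) : (V →ₗ[ℝ] ℝ) →ₗ[ℝ] V :=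
  (TensorProduct.rid ℝ V).toLinearMap ∘ₗ LinearMap.applyₗ φ ∘ₗ LinearMap.lTensorHom V

theorem apply_steeringMap {V : Type*} [AddCommGroup V] [Module ℝ V]
    (φ : TensorProduct ℝ V V) (h h' : V →ₗ[ℝ] ℝ) :
    h (steeringMap φ h') = tpair h h' φ := by
  induction φ using TensorProduct.induction_on with
  | zero => simp [steeringMap]
  | tmul v w => simp [steeringMap, tpair, mul_comm]
  | add a b ha hb =>
    rw [map_add, ← ha, ← hb]
    simp [steeringMap]

theorem apply_steeringMap_comm {V : Type*} [AddCommGroup V] [Module ℝ V]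
    (φ : TensorProduct ℝ V V) (h h' : V →ₗ[ℝ] ℝ) :
    h (steeringMap (TensorProduct.comm ℝ V V φ) h') = tpair h' h φ := by
  rw [apply_steeringMap]
  induction φ using TensorProduct.induction_on with
  | zero => simp
  | tmul v w => simp [tpair, mul_comm]
  | add a b ha hb => simp [ha, hb]

/-- A closed convex set in the hyperplane `u = 1` contains every point of that hyperplane on
which all functionals that are nonnegative on the set are nonnegative. -/
theorem mem_of_forall_nonneg_functional {V : Type*} [NormedAddCommGroup V] [NormedSpace ℝ V]
    {u : V →ₗ[ℝ] ℝ} {K : Set V} (hK : IsClosed K) (hKconv : Convex ℝ K)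
    (hKu : ∀ x ∈ K, u x = 1) {v : V} (hv : u v = 1)
    (hpos : ∀ h : V →ₗ[ℝ] ℝ, (∀ x ∈ K, 0 ≤ h x) → 0 ≤ h v) : v ∈ K := by
  by_contra hvK
  obtain ⟨f, s, hf, hs⟩ := geometric_hahn_banach_closed_point hKconv hK hvK
  have key := hpos (s • u - f.toLinearMap) fun x hx => by
    simpa [hKu x hx] using (hf x hx).le
  simp [hv] at key
  linarith

/-- If the steering map `T` of a bipartite state attains the maximal CHSH value, then the pair
of effects on the steered side admits a witness square. -/
theorem exists_isWitnessSquare_of_chsh {V : Type*} [NormedAddCommGroup V] [NormedSpace ℝ V]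
    {u : V →ₗ[ℝ] ℝ} {K : Set V} (hK : IsClosed K) (hKconv : Convex ℝ K)
    (hKu : ∀ x ∈ K, u x = 1) (T : (V →ₗ[ℝ] ℝ) →ₗ[ℝ] V)
    (hpos : ∀ h h' : V →ₗ[ℝ] ℝ, (∀ x ∈ K, 0 ≤ h x) → (∀ x ∈ K, 0 ≤ h' x) → 0 ≤ h (T h'))
    (hnorm : u (T u) = 1) {f f' g g' : V →ₗ[ℝ] ℝ}
    (hf : IsLinEffect K f) (hf' : IsLinEffect K f')
    (hg : IsLinEffect K g) (hg' : IsLinEffect K g')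
    (hX : ((2:ℝ) • f - u) (T ((2:ℝ) • g - u)) + ((2:ℝ) • f - u) (T ((2:ℝ) • g' - u))
        + ((2:ℝ) • f' - u) (T ((2:ℝ) • g - u)) - ((2:ℝ) • f' - u) (T ((2:ℝ) • g' - u)) = 4) :
    ∃ x, IsWitnessSquare K f f' x := by
  have compl {e : V →ₗ[ℝ] ℝ} (he : IsLinEffect K e) : ∀ x ∈ K, 0 ≤ (u - e) x := fun x hx => by
    simpa [hKu x hx] using (he x hx).2
  have nonneg {e : V →ₗ[ℝ] ℝ} (he : IsLinEffect K e) : ∀ x ∈ K, 0 ≤ e x := fun x hx => (he x hx).1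
  have mem {e : V →ₗ[ℝ] ℝ} (he : ∀ x ∈ K, 0 ≤ e x) (hue : u (T e) = 1 / 2) :
      (2:ℝ) • T e ∈ K := by
    refine mem_of_forall_nonneg_functional hK hKconv hKu (by simp [hue]) fun h hh => ?_
    have := hpos h e hh he
    simpa using this
  have h1 := hpos f (u - g) (nonneg hf) (compl hg)
  have h2 := hpos (u - f) g (compl hf) (nonneg hg)
  have h3 := hpos f (u - g') (nonneg hf) (compl hg')
  have h4 := hpos (u - f) g' (compl hf) (nonneg hg')
  have h5 := hpos f' (u - g) (nonneg hf') (compl hg)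
  have h6 := hpos (u - f') g (compl hf') (nonneg hg)
  have h7 := hpos f' g' (nonneg hf') (nonneg hg')
  have h8 := hpos (u - f') (u - g') (compl hf') (compl hg')
  simp only [map_sub, map_smul, LinearMap.sub_apply, LinearMap.smul_apply, smul_eq_mul]
    at hX h1 h2 h3 h4 h5 h6 h7 h8
  have hg2 : u (T g) = 1 / 2 := by linarith
  have hg2' : u (T g') = 1 / 2 := by linarith
  refine ⟨![![(2:ℝ) • T (u - g), (2:ℝ) • T (u - g')], ![(2:ℝ) • T g', (2:ℝ) • T g]],
    ?_, ?_, ?_, ?_⟩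
  · have m1 := mem (compl hg) (by simp only [map_sub]; linarith)
    have m2 := mem (compl hg') (by simp only [map_sub]; linarith)
    have m3 := mem (nonneg hg) hg2
    have m4 := mem (nonneg hg') hg2'
    intro i j
    fin_cases i <;> fin_cases j <;> assumption
  · simp [smul_sub]
  · intro i j
    fin_cases i <;> fin_cases j <;> simp <;> linarith
  · intro i j
    fin_cases i <;> fin_cases j <;> simp <;> linarith

/-- If a state `φ` of the maximal tensor product `K ⊗̂ K` together with effects
`f_A, f_{A'}` on the first factor and `f_B, f_{B'}` on the second attains the maximal
CHSH value `X = 4`, then both pairs `(f_A, f_{A'})` and `(f_B, f_{B'})` admit witness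
squares, i.e. both pairs of two-outcome measurements are maximally incompatible. -/
theorem chsh_max_implies_maximally_incompatible
    {V : Type*} [NormedAddCommGroup V] [NormedSpace ℝ V] [FiniteDimensional ℝ V]
    (u : V →ₗ[ℝ] ℝ) (K : Set V) (hK : IsCompact K) (hKconv : Convex ℝ K)
    (hKu : ∀ x ∈ K, u x = 1)
    (φ : TensorProduct ℝ V V)
    (hφpos : ∀ h h' : V →ₗ[ℝ] ℝ, (∀ x ∈ K, 0 ≤ h x) → (∀ x ∈ K, 0 ≤ h' x) →
      0 ≤ tpair h h' φ)
    (hφnorm : tpair u u φ = 1)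
    (fA fA' fB fB' : V →ₗ[ℝ] ℝ)
    (hfA : IsLinEffect K fA) (hfA' : IsLinEffect K fA')
    (hfB : IsLinEffect K fB) (hfB' : IsLinEffect K fB')
    (hX : tpair ((2:ℝ) • fA - u) ((2:ℝ) • fB - u) φ
        + tpair ((2:ℝ) • fA - u) ((2:ℝ) • fB' - u) φ
        + tpair ((2:ℝ) • fA' - u) ((2:ℝ) • fB - u) φ
        - tpair ((2:ℝ) • fA' - u) ((2:ℝ) • fB' - u) φ = 4) :
    (∃ x, IsWitnessSquare K fA fA' x) ∧ (∃ y, IsWitnessSquare K fB fB' y) := by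
  refine ⟨exists_isWitnessSquare_of_chsh hK.isClosed hKconv hKu (steeringMap φ) ?_ ?_
    hfA hfA' hfB hfB' ?_, exists_isWitnessSquare_of_chsh hK.isClosed hKconv hKu
    (steeringMap (TensorProduct.comm ℝ V V φ)) ?_ ?_ hfB hfB' hfA hfA' ?_⟩
  · simpa only [apply_steeringMap] using hφpos
  · rwa [apply_steeringMap]
  · simpa only [apply_steeringMap] using hX
  · intro h h' hh hh'
    simpa only [apply_steeringMap_comm] using hφpos h' h hh' hh
  · rwa [apply_steeringMap_comm]
  · simp only [apply_steeringMap_comm]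
    linarith
end

section
/- Let V be a finite-dimensional real vector space, u : V → ℝ linear, K ⊆ {v : u(v) = 1} compact convex, φ ∈ K ⊗̂ K, and let f_A, f_{A'}, f_B, f_{B'} be linear effects whose CHSH quantity on φ equals 4. Then there exist witness squares {x_{ij}} for (f_A, f_{A'}) and {y_{ij}} for (f_B, f_{B'}) such that φ^⊥ := φ − ½((x₀₀ − x₁₀) ⊗ y₀₀ + x₁₁ ⊗ y₁₀ + x₁₀ ⊗ y₀₁) lies in the subspace W_A ⊗ W_B of V ⊗ V, where W_A = ker f_A ∩ ker f_{A'} ∩ ker u and W_B = ker f_B ∩ ker f_{B'} ∩ ker u. -/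
open TensorProduct

/-- A linear map over a field has a generalized inverse. -/
theorem LinearMap.exists_comp_comp_eq_self {k X Y : Type*} [Field k]
    [AddCommGroup X] [Module k X] [AddCommGroup Y] [Module k Y] (T : X →ₗ[k] Y) :
    ∃ s : Y →ₗ[k] X, T ∘ₗ s ∘ₗ T = T := by
  obtain ⟨r, hr⟩ := T.rangeRestrict.exists_rightInverse_of_surjective T.range_rangeRestrict
  obtain ⟨s, hs⟩ := LinearMap.exists_extend r
  refine ⟨s, LinearMap.ext fun v => ?_⟩
  have h₁ : s (T v) = r (T.rangeRestrict v) := LinearMap.congr_fun hs (T.rangeRestrict v)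
  have h₂ := congrArg Subtype.val (LinearMap.congr_fun hr (T.rangeRestrict v))
  rw [LinearMap.comp_apply, LinearMap.comp_apply, h₁]
  exact h₂

/-- A tensor annihilated by `F ⊗ id` and by `id ⊗ G` lies in `ker F ⊗ ker G`. -/
theorem mem_range_mapIncl_ker {k V V' M N : Type*} [Field k] [AddCommGroup V] [Module k V]
    [AddCommGroup V'] [Module k V'] [AddCommGroup M] [Module k M] [AddCommGroup N] [Module k N]
    (F : V →ₗ[k] M) (G : V' →ₗ[k] N) (ψ : V ⊗[k] V')
    (hF : F.rTensor V' ψ = 0) (hG : G.lTensor V ψ = 0) :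
    ψ ∈ LinearMap.range (TensorProduct.mapIncl (LinearMap.ker F) (LinearMap.ker G)) := by
  obtain ⟨s, hs⟩ := F.exists_comp_comp_eq_self
  obtain ⟨t, ht⟩ := G.exists_comp_comp_eq_self
  have hp : ∀ v, ((LinearMap.id : V →ₗ[k] V) - s ∘ₗ F) v ∈ LinearMap.ker F := fun v => by
    have := LinearMap.congr_fun hs v
    simp only [LinearMap.comp_apply] at this
    simp [this]
  have hq : ∀ v, ((LinearMap.id : V' →ₗ[k] V') - t ∘ₗ G) v ∈ LinearMap.ker G := fun v => by
    have := LinearMap.congr_fun ht v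
    simp only [LinearMap.comp_apply] at this
    simp [this]
  refine ⟨TensorProduct.map (LinearMap.codRestrict _ _ hp) (LinearMap.codRestrict _ _ hq) ψ, ?_⟩
  rw [TensorProduct.mapIncl, ← LinearMap.comp_apply, ← TensorProduct.map_comp,
    LinearMap.subtype_comp_codRestrict, LinearMap.subtype_comp_codRestrict,
    ← LinearMap.rTensor_comp_lTensor, LinearMap.comp_apply, LinearMap.lTensor_sub,
    LinearMap.lTensor_comp, LinearMap.sub_apply, LinearMap.comp_apply, hG, LinearMap.rTensor_sub,
    LinearMap.rTensor_comp]
  simp [hF]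

theorem rTensor_prod_apply_eq_zero {k V V' M N : Type*} [CommRing k] [AddCommGroup V] [Module k V]
    [AddCommGroup V'] [Module k V'] [AddCommGroup M] [Module k M] [AddCommGroup N] [Module k N]
    {F : V →ₗ[k] M} {G : V →ₗ[k] N} {ψ : V ⊗[k] V'}
    (hF : F.rTensor V' ψ = 0) (hG : G.rTensor V' ψ = 0) : (F.prod G).rTensor V' ψ = 0 := by
  have h : F.prod G = LinearMap.inl k M N ∘ₗ F + LinearMap.inr k M N ∘ₗ G := by ext <;> simp
  rw [h, LinearMap.rTensor_add, LinearMap.rTensor_comp, LinearMap.rTensor_comp]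
  simp [hF, hG]

theorem lTensor_prod_apply_eq_zero {k V V' M N : Type*} [CommRing k] [AddCommGroup V] [Module k V]
    [AddCommGroup V'] [Module k V'] [AddCommGroup M] [Module k M] [AddCommGroup N] [Module k N]
    {F : V →ₗ[k] M} {G : V →ₗ[k] N} {ψ : V' ⊗[k] V}
    (hF : F.lTensor V' ψ = 0) (hG : G.lTensor V' ψ = 0) : (F.prod G).lTensor V' ψ = 0 := by
  have h : F.prod G = LinearMap.inl k M N ∘ₗ F + LinearMap.inr k M N ∘ₗ G := by ext <;> simp
  rw [h, LinearMap.lTensor_add, LinearMap.lTensor_comp, LinearMap.lTensor_comp]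
  simp [hF, hG]

/-- Contraction of the first tensor factor with a functional. -/
noncomputable def contractFst {V : Type*} [AddCommGroup V] [Module ℝ V]
    (h : V →ₗ[ℝ] ℝ) : V ⊗[ℝ] V →ₗ[ℝ] V :=
  (TensorProduct.lid ℝ V).toLinearMap ∘ₗ h.rTensor V

/-- Contraction of the second tensor factor with a functional. -/
noncomputable def contractSnd {V : Type*} [AddCommGroup V] [Module ℝ V]
    (h : V →ₗ[ℝ] ℝ) : V ⊗[ℝ] V →ₗ[ℝ] V :=
  (TensorProduct.rid ℝ V).toLinearMap ∘ₗ h.lTensor V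

section Contraction

variable {V : Type*} [AddCommGroup V] [Module ℝ V] (g h : V →ₗ[ℝ] ℝ)

@[simp]
theorem contractFst_tmul (v w : V) : contractFst h (v ⊗ₜ w) = h v • w := by
  simp [contractFst]

@[simp]
theorem contractSnd_tmul (v w : V) : contractSnd h (v ⊗ₜ w) = h w • v := by
  simp [contractSnd]

theorem contractFst_sub : contractFst (g - h) = contractFst g - contractFst h := by
  simp [contractFst, LinearMap.rTensor_sub, LinearMap.comp_sub]

theorem contractSnd_sub : contractSnd (g - h) = contractSnd g - contractSnd h := by
  simp [contractSnd, LinearMap.lTensor_sub, LinearMap.comp_sub]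

theorem tpair_eq_contractFst (φ : V ⊗[ℝ] V) : tpair g h φ = h (contractFst g φ) := by
  have : tpair g h = h ∘ₗ contractFst g := by
    ext v w
    simp [tpair]
  rw [this, LinearMap.comp_apply]

theorem tpair_eq_contractSnd (φ : V ⊗[ℝ] V) : tpair g h φ = g (contractSnd h φ) := by
  have : tpair g h = g ∘ₗ contractSnd h := by
    ext v w
    simp [tpair, mul_comm]
  rw [this, LinearMap.comp_apply]

variable (φ : V ⊗[ℝ] V)

theorem tpair_sub_left (g' : V →ₗ[ℝ] ℝ) :
    tpair (g - g') h φ = tpair g h φ - tpair g' h φ := by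
  simp [tpair_eq_contractSnd]

theorem tpair_sub_right (h' : V →ₗ[ℝ] ℝ) :
    tpair g (h - h') φ = tpair g h φ - tpair g h' φ := by
  simp [tpair_eq_contractFst]

theorem tpair_smul_left (c : ℝ) : tpair (c • g) h φ = c * tpair g h φ := by
  simp [tpair_eq_contractSnd]

theorem tpair_smul_right (c : ℝ) : tpair g (c • h) φ = c * tpair g h φ := by
  simp [tpair_eq_contractFst]

/-- A tensor whose contractions with three functionals on each side vanish lies in the tensor
product of the joint kernels. -/
theorem mem_range_mapIncl_of_contract_eq_zero {f f' u g g' w : V →ₗ[ℝ] ℝ} {ψ : V ⊗[ℝ] V}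
    (hf : contractFst f ψ = 0) (hf' : contractFst f' ψ = 0) (hu : contractFst u ψ = 0)
    (hg : contractSnd g ψ = 0) (hg' : contractSnd g' ψ = 0) (hw : contractSnd w ψ = 0) :
    ψ ∈ LinearMap.range (TensorProduct.mapIncl
      (LinearMap.ker f ⊓ LinearMap.ker f' ⊓ LinearMap.ker u)
      (LinearMap.ker g ⊓ LinearMap.ker g' ⊓ LinearMap.ker w)) := by
  simp only [contractFst, contractSnd, LinearMap.comp_apply, LinearEquiv.coe_coe,
    LinearEquiv.map_eq_zero_iff] at hf hf' hu hg hg' hw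
  rw [← LinearMap.ker_prod, ← LinearMap.ker_prod, ← LinearMap.ker_prod, ← LinearMap.ker_prod]
  exact mem_range_mapIncl_ker _ _ _
    (rTensor_prod_apply_eq_zero (rTensor_prod_apply_eq_zero hf hf') hu)
    (lTensor_prod_apply_eq_zero (lTensor_prod_apply_eq_zero hg hg') hw)

end Contraction

/-- A normalized vector on which all positive functionals are nonnegative is a state. -/
theorem mem_of_forall_positive {V : Type*} [NormedAddCommGroup V] [NormedSpace ℝ V]
    {u : V →ₗ[ℝ] ℝ} {K : Set V} (hK : IsClosed K) (hKconv : Convex ℝ K)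
    (hKu : ∀ x ∈ K, u x = 1) {v : V} (huv : u v = 1)
    (hv : ∀ h : V →ₗ[ℝ] ℝ, (∀ x ∈ K, 0 ≤ h x) → 0 ≤ h v) : v ∈ K := by
  by_contra hvK
  obtain ⟨f, s, hfv, hfK⟩ := geometric_hahn_banach_point_closed hKconv hK hvK
  have h := hv ((f : V →ₗ[ℝ] ℝ) - s • u) fun x hx => by
    simpa [hKu x hx] using (hfK x hx).le
  simp [huv] at h
  linarith

/-- Structure of all maximal violations of the CHSH inequality: if `φ ∈ K ⊗̂ K` attains
`X_CHSH = 4` for effects `f_A, f_{A'}, f_B, f_{B'}`, then there are witness squares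
`{x i j}` for `(f_A, f_{A'})` and `{y i j}` for `(f_B, f_{B'})` such that
`φ − ½((x₀₀ − x₁₀) ⊗ y₀₀ + x₁₁ ⊗ y₁₀ + x₁₀ ⊗ y₀₁)` lies in `W_A ⊗ W_B`, where
`W_A = ker f_A ∩ ker f_{A'} ∩ ker u` and `W_B = ker f_B ∩ ker f_{B'} ∩ ker u`. -/
theorem chsh_max_structure
    {V : Type*} [NormedAddCommGroup V] [NormedSpace ℝ V] [FiniteDimensional ℝ V]
    (u : V →ₗ[ℝ] ℝ) (K : Set V) (hK : IsCompact K) (hKconv : Convex ℝ K)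
    (hKu : ∀ x ∈ K, u x = 1)
    (φ : TensorProduct ℝ V V)
    (hφpos : ∀ h h' : V →ₗ[ℝ] ℝ, (∀ x ∈ K, 0 ≤ h x) → (∀ x ∈ K, 0 ≤ h' x) →
      0 ≤ tpair h h' φ)
    (hφnorm : tpair u u φ = 1)
    (fA fA' fB fB' : V →ₗ[ℝ] ℝ)
    (hfA : IsLinEffect K fA) (hfA' : IsLinEffect K fA')
    (hfB : IsLinEffect K fB) (hfB' : IsLinEffect K fB')
    (hX : tpair ((2:ℝ) • fA - u) ((2:ℝ) • fB - u) φ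
        + tpair ((2:ℝ) • fA - u) ((2:ℝ) • fB' - u) φ
        + tpair ((2:ℝ) • fA' - u) ((2:ℝ) • fB - u) φ
        - tpair ((2:ℝ) • fA' - u) ((2:ℝ) • fB' - u) φ = 4) :
    ∃ x y : Fin 2 → Fin 2 → V,
      IsWitnessSquare K fA fA' x ∧ IsWitnessSquare K fB fB' y ∧
      φ - (1/2 : ℝ) • ((x 0 0 - x 1 0) ⊗ₜ[ℝ] y 0 0 + x 1 1 ⊗ₜ[ℝ] y 1 0
          + x 1 0 ⊗ₜ[ℝ] y 0 1)
        ∈ LinearMap.range (TensorProduct.mapIncl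
            (LinearMap.ker fA ⊓ LinearMap.ker fA' ⊓ LinearMap.ker u)
            (LinearMap.ker fB ⊓ LinearMap.ker fB' ⊓ LinearMap.ker u)) := by
  have pos : ∀ {f : V →ₗ[ℝ] ℝ}, IsLinEffect K f → ∀ x ∈ K, 0 ≤ f x := fun hf x hx => (hf x hx).1
  have copos : ∀ {f : V →ₗ[ℝ] ℝ}, IsLinEffect K f → ∀ x ∈ K, 0 ≤ (u - f) x := fun hf x hx => by
    simpa [hKu x hx] using (hf x hx).2
  have joint : ∀ {f g : V →ₗ[ℝ] ℝ}, IsLinEffect K f → IsLinEffect K g →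
      0 ≤ tpair f g φ ∧ 0 ≤ tpair f u φ - tpair f g φ ∧ 0 ≤ tpair u g φ - tpair f g φ ∧
        0 ≤ 1 - tpair f u φ - tpair u g φ + tpair f g φ := fun {f g} hf hg => by
    have h₁ := hφpos _ _ (pos hf) (copos hg)
    have h₂ := hφpos _ _ (copos hf) (pos hg)
    have h₃ := hφpos _ _ (copos hf) (copos hg)
    simp only [tpair_sub_left, tpair_sub_right, hφnorm] at h₁ h₂ h₃
    exact ⟨hφpos _ _ (pos hf) (pos hg), h₁, h₂, by linarith⟩
  simp only [tpair_sub_left, tpair_sub_right, tpair_smul_left, tpair_smul_right, hφnorm] at hX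
  obtain ⟨a₁, a₂, a₃, a₄⟩ := joint hfA hfB
  obtain ⟨b₁, b₂, b₃, b₄⟩ := joint hfA hfB'
  obtain ⟨c₁, c₂, c₃, c₄⟩ := joint hfA' hfB
  obtain ⟨d₁, d₂, d₃, d₄⟩ := joint hfA' hfB'
  have pA : tpair fA u φ = 1 / 2 := by linarith
  have pA' : tpair fA' u φ = 1 / 2 := by linarith
  have pB : tpair u fB φ = 1 / 2 := by linarith
  have pB' : tpair u fB' φ = 1 / 2 := by linarith
  have pAB : tpair fA fB φ = 1 / 2 := by linarith
  have pAB' : tpair fA fB' φ = 1 / 2 := by linarith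
  have pA'B : tpair fA' fB φ = 1 / 2 := by linarith
  have pA'B' : tpair fA' fB' φ = 0 := by linarith
  clear a₁ a₂ a₃ a₄ b₁ b₂ b₃ b₄ c₁ c₂ c₃ c₄ d₁ d₂ d₃ d₄ hX
  have memL : ∀ {h : V →ₗ[ℝ] ℝ}, (∀ x ∈ K, 0 ≤ h x) → tpair h u φ = 1 / 2 →
      (2 : ℝ) • contractFst h φ ∈ K := fun {h} hh hn =>
    mem_of_forall_positive hK.isClosed hKconv hKu
      (by rw [map_smul, ← tpair_eq_contractFst, hn]; norm_num) fun h' hh' => by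
        rw [map_smul, ← tpair_eq_contractFst]
        exact smul_nonneg zero_le_two (hφpos h h' hh hh')
  have memR : ∀ {h : V →ₗ[ℝ] ℝ}, (∀ x ∈ K, 0 ≤ h x) → tpair u h φ = 1 / 2 →
      (2 : ℝ) • contractSnd h φ ∈ K := fun {h} hh hn =>
    mem_of_forall_positive hK.isClosed hKconv hKu
      (by rw [map_smul, ← tpair_eq_contractSnd, hn]; norm_num) fun h' hh' => by
        rw [map_smul, ← tpair_eq_contractSnd]
        exact smul_nonneg zero_le_two (hφpos h' h hh' hh)
  have hx : IsWitnessSquare K fA fA'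
      ![![(2 : ℝ) • contractSnd (u - fB) φ, (2 : ℝ) • contractSnd (u - fB') φ],
        ![(2 : ℝ) • contractSnd fB' φ, (2 : ℝ) • contractSnd fB φ]] := by
    refine ⟨?_, ?_, ?_, ?_⟩
    · simp only [Fin.forall_fin_two]
      refine ⟨⟨memR (copos hfB) ?_, memR (copos hfB') ?_⟩,
        memR (pos hfB') pB', memR (pos hfB) pB⟩ <;>
      · simp only [tpair_sub_right, hφnorm, pB, pB']
        norm_num
    · simp [contractSnd_sub, smul_sub]
    · simp [Fin.forall_fin_two, ← tpair_eq_contractSnd, tpair_sub_right, *]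
    · simp [Fin.forall_fin_two, ← tpair_eq_contractSnd, tpair_sub_right, *]
  have hy : IsWitnessSquare K fB fB'
      ![![(2 : ℝ) • contractFst (u - fA) φ, (2 : ℝ) • contractFst (u - fA') φ],
        ![(2 : ℝ) • contractFst fA' φ, (2 : ℝ) • contractFst fA φ]] := by
    refine ⟨?_, ?_, ?_, ?_⟩
    · simp only [Fin.forall_fin_two]
      refine ⟨⟨memL (copos hfA) ?_, memL (copos hfA') ?_⟩,
        memL (pos hfA') pA', memL (pos hfA) pA⟩ <;>
      · simp only [tpair_sub_left, hφnorm, pA, pA']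
        norm_num
    · simp [contractFst_sub, smul_sub]
    · simp [Fin.forall_fin_two, ← tpair_eq_contractFst, tpair_sub_left, *]
    · simp [Fin.forall_fin_two, ← tpair_eq_contractFst, tpair_sub_left, *]
  refine ⟨_, _, hx, hy, ?_⟩
  obtain ⟨hxK, -, hxA, hxA'⟩ := hx
  obtain ⟨hyK, -, hyB, hyB'⟩ := hy
  apply mem_range_mapIncl_of_contract_eq_zero
  all_goals
    simp only [map_sub, map_smul, map_add, contractFst_tmul, contractSnd_tmul, hxA, hxA', hyB,
      hyB', hKu _ (hxK _ _), hKu _ (hyK _ _)]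
    simp [contractFst_sub, contractSnd_sub]
    try module
end

section
/- Let V be a finite-dimensional real vector space, u : V → ℝ linear, K ⊆ {v : u(v) = 1} compact convex, and let x₀₀, x₁₀, x₀₁, x₁₁ ∈ K satisfy x₀₀ + x₁₁ = x₁₀ + x₀₁. Then φ := ½((x₀₀ − x₁₀) ⊗ x₀₀ + x₁₁ ⊗ x₁₀ + x₁₀ ⊗ x₀₁) belongs to the maximal tensor product K ⊗̂ K, i.e., (h ⊗ h')(φ) ≥ 0 for all linear functionals h, h' nonnegative on K, and (u ⊗ u)(φ) = 1. -/
open TensorProduct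

/-- If `x₀₀, x₁₀, x₀₁, x₁₁ ∈ K` satisfy `x₀₀ + x₁₁ = x₁₀ + x₀₁`, then
`φ = ½((x₀₀ − x₁₀) ⊗ x₀₀ + x₁₁ ⊗ x₁₀ + x₁₀ ⊗ x₀₁)` belongs to the maximal tensor
product `K ⊗̂ K`: it pairs nonnegatively with `h ⊗ h'` for all linear functionals
`h, h'` nonnegative on `K`, and `(u ⊗ u)(φ) = 1`. -/
theorem witness_square_state_mem_maxTensor
    {V : Type*} [NormedAddCommGroup V] [NormedSpace ℝ V] [FiniteDimensional ℝ V]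
    (u : V →ₗ[ℝ] ℝ) (K : Set V) (hK : IsCompact K) (hKconv : Convex ℝ K)
    (hKu : ∀ x ∈ K, u x = 1)
    (x₀₀ x₁₀ x₀₁ x₁₁ : V)
    (h00 : x₀₀ ∈ K) (h10 : x₁₀ ∈ K) (h01 : x₀₁ ∈ K) (h11 : x₁₁ ∈ K)
    (hsq : x₀₀ + x₁₁ = x₁₀ + x₀₁) :
    (∀ h h' : V →ₗ[ℝ] ℝ, (∀ v ∈ K, 0 ≤ h v) → (∀ v ∈ K, 0 ≤ h' v) →
      0 ≤ tpair h h' ((1/2 : ℝ) • ((x₀₀ - x₁₀) ⊗ₜ[ℝ] x₀₀ + x₁₁ ⊗ₜ[ℝ] x₁₀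
        + x₁₀ ⊗ₜ[ℝ] x₀₁))) ∧
    tpair u u ((1/2 : ℝ) • ((x₀₀ - x₁₀) ⊗ₜ[ℝ] x₀₀ + x₁₁ ⊗ₜ[ℝ] x₁₀
        + x₁₀ ⊗ₜ[ℝ] x₀₁)) = 1 := by
  have expand : ∀ f g : V →ₗ[ℝ] ℝ,
      tpair f g ((1/2 : ℝ) • ((x₀₀ - x₁₀) ⊗ₜ[ℝ] x₀₀ + x₁₁ ⊗ₜ[ℝ] x₁₀ + x₁₀ ⊗ₜ[ℝ] x₀₁)) =
        1 / 2 * ((f x₀₀ - f x₁₀) * g x₀₀ + f x₁₁ * g x₁₀ + f x₁₀ * g x₀₁) := by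
    intro f g
    simp [tpair]
    ring
  refine ⟨fun h h' hh hh' => ?_, ?_⟩
  · rw [expand]
    have hs : h x₀₀ + h x₁₁ = h x₁₀ + h x₀₁ := by simpa using congrArg h hsq
    have a0 := hh' _ h00
    have b0 := hh' _ h10
    have bc := mul_nonneg (hh _ h10) (hh' _ h01)
    have db := mul_nonneg (hh _ h11) b0
    have hsum : 0 ≤ (h x₀₀ - h x₁₀) * h' x₀₀ + h x₁₁ * h' x₁₀ + h x₁₀ * h' x₀₁ := by
      rcases le_total (h x₁₀) (h x₀₀) with hab | hab
      · have := mul_nonneg (sub_nonneg.2 hab) a0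
        linarith
      rcases le_total (h' x₁₀) (h' x₀₀) with hab' | hab'
      · have hs' : h' x₀₁ = h' x₀₀ + h' x₁₁ - h' x₁₀ := by
          have : h' x₀₀ + h' x₁₁ = h' x₁₀ + h' x₀₁ := by simpa using congrArg h' hsq
          linarith
        have hd : h x₁₁ = h x₁₀ + h x₀₁ - h x₀₀ := by linarith
        rw [hs', hd]
        nlinarith [mul_nonneg (hh _ h00) (sub_nonneg.2 hab'), mul_nonneg (hh _ h01) b0,
          mul_nonneg (hh _ h10) (hh' _ h11)]
      · have hd : h x₁₁ = h x₁₀ + h x₀₁ - h x₀₀ := by linarith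
        rw [hd]
        nlinarith [mul_nonneg (sub_nonneg.2 hab) (sub_nonneg.2 hab'),
          mul_nonneg (hh _ h01) b0]
    positivity
  · rw [expand, hKu _ h00, hKu _ h10, hKu _ h01, hKu _ h11]
    norm_num
end
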